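/- arXiv:1406.2999 — 2 statements merged into one kernel-verified Lean document; each statement's English description precedes it below -/
import Mathlib

section
/- Let p ≥ 5 be a prime, let k be a positive integer, let F ∈ ℤ_(p)[Q,R] be isobaric of weight k and not involving P, and let n be the unique integer with 0 ≤ np−k+1 < p. Then D^{np−k+1}F is congruent modulo p to a modular form of weight 2np−k+2; precisely, there exists a polynomial G ∈ ℤ_(p)[Q,R], isobaric of weight 2np−k+2 and not involving P, such that D^{np−k+1}F − G ∈ p·ℤ_(p)[P,Q,R]. -/
open MvPolynomial Finset

noncomputable section

/-- `x` lies in `ℤ_(p) ⊆ ℚ`: `p` does not divide the reduced denominator of `x`. -/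
def pInt (p : ℕ) (x : ℚ) : Prop := ¬ p ∣ x.den

/-- The polynomial ring `ℚ[P,Q,R]`, with `P = X 0`, `Q = X 1`, `R = X 2`. -/
abbrev Poly3 : Type := MvPolynomial (Fin 3) ℚ

/-- `f` has all of its coefficients in `ℤ_(p)`. -/
def polyPInt (p : ℕ) (f : Poly3) : Prop := ∀ m : Fin 3 →₀ ℕ, pInt p (coeff m f)

/-- `f` is isobaric of weight `w`, where `P, Q, R` have weights `2, 4, 6`. -/
def Isobaric (w : ℕ) (f : Poly3) : Prop :=
  ∀ m ∈ f.support, 2 * m 0 + 4 * m 1 + 6 * m 2 = w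

/-- `f` does not involve the variable `P`. -/
def NoP (f : Poly3) : Prop := ∀ m ∈ f.support, m 0 = 0

/-- The Ramanujan derivation `D` on `ℚ[P,Q,R]`, the unique derivation with
`DP = (P²-Q)/12`, `DQ = (PQ-R)/3`, `DR = (PR-Q²)/2`. -/
def Dop (f : Poly3) : Poly3 :=
  C (1/12 : ℚ) * (X 0 ^ 2 - X 1) * pderiv 0 f
    + C (1/3 : ℚ) * (X 0 * X 1 - X 2) * pderiv 1 f
    + C (1/2 : ℚ) * (X 0 * X 2 - X 1 ^ 2) * pderiv 2 f

/-- The sum of the `j`-th powers of the divisors of `n`, as a rational number. -/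
def sigmaQ (j n : ℕ) : ℚ := ∑ d ∈ n.divisors, (d : ℚ) ^ j

/-- The q-expansion of `E₂`. -/
def E2s : PowerSeries ℚ := PowerSeries.mk fun n => if n = 0 then 1 else -24 * sigmaQ 1 n

/-- The q-expansion of `E₄`. -/
def E4s : PowerSeries ℚ := PowerSeries.mk fun n => if n = 0 then 1 else 240 * sigmaQ 3 n

/-- The q-expansion of `E₆`. -/
def E6s : PowerSeries ℚ := PowerSeries.mk fun n => if n = 0 then 1 else -504 * sigmaQ 5 n

/-- The q-expansion of the normalized Eisenstein series `E_{p-1}`. -/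
def EAs (p : ℕ) : PowerSeries ℚ :=
  PowerSeries.mk fun n => if n = 0 then 1 else
    -(2 * ((p : ℚ) - 1) / bernoulli (p - 1)) * sigmaQ (p - 2) n

/-- The q-expansion of the normalized Eisenstein series `E_{p+1}`. -/
def EBs (p : ℕ) : PowerSeries ℚ :=
  PowerSeries.mk fun n => if n = 0 then 1 else
    -(2 * ((p : ℚ) + 1) / bernoulli (p + 1)) * sigmaQ p n

/-- `Φ : ℚ[P,Q,R] → ℚ[[q]]`, the algebra map sending `P, Q, R` to `E₂, E₄, E₆`. -/
def Phi : Poly3 →ₐ[ℚ] PowerSeries ℚ := aeval ![E2s, E4s, E6s]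

/-- The theta operator attached to the polynomials `A` and `B`:
`θf = ((BQ-AR)/3)·∂f/∂Q + ((BR-AQ²)/2)·∂f/∂R`. -/
def thetaOp (A B f : Poly3) : Poly3 :=
  C (1/3 : ℚ) * (B * X 1 - A * X 2) * pderiv 1 f
    + C (1/2 : ℚ) * (B * X 2 - A * X 1 ^ 2) * pderiv 2 f

/-- `f` lies in the `n`-th power of the ideal `(A^p, p)` of `ℤ_(p)[P,Q,R]`. -/
def InIdealPow (p : ℕ) (A : Poly3) (n : ℕ) (f : Poly3) : Prop :=
  ∃ G : ℕ → Poly3, (∀ i, polyPInt p (G i)) ∧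
    f = ∑ i ∈ Finset.range (n + 1), (p : Poly3) ^ (n - i) * A ^ (p * i) * G i


theorem aux_pInt_add {p : ℕ} (hp : p.Prime) {x y : ℚ} (hx : pInt p x) (hy : pInt p y) :
    pInt p (x + y) := fun h =>
  ((hp.dvd_mul).1 (h.trans (Rat.add_den_dvd x y))).elim hx hy

theorem aux_pInt_mul {p : ℕ} (hp : p.Prime) {x y : ℚ} (hx : pInt p x) (hy : pInt p y) :
    pInt p (x * y) := fun h =>
  ((hp.dvd_mul).1 (h.trans (Rat.mul_den_dvd x y))).elim hx hy

theorem aux_pInt_int {p : ℕ} (hp : p.Prime) (z : ℤ) : pInt p (z : ℚ) := by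
  simp [pInt, hp.one_lt.ne']

theorem aux_pInt_nat {p : ℕ} (hp : p.Prime) (z : ℕ) : pInt p (z : ℚ) := by
  simp [pInt, hp.one_lt.ne']

theorem aux_pInt_inv {p : ℕ} (d : ℕ) (hd : ¬ p ∣ d) : pInt p ((d : ℚ)⁻¹) := by
  intro h
  have hd0 : d ≠ 0 := by rintro rfl; simp at hd
  rw [Rat.inv_natCast_den] at h
  simp [hd0] at h
  exact hd h

theorem aux_poly_add {p : ℕ} (hp : p.Prime) {f g : Poly3} (hf : polyPInt p f)
    (hg : polyPInt p g) : polyPInt p (f + g) := fun m => by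
  rw [coeff_add]; exact aux_pInt_add hp (hf m) (hg m)

theorem aux_poly_mul {p : ℕ} (hp : p.Prime) {f g : Poly3} (hf : polyPInt p f)
    (hg : polyPInt p g) : polyPInt p (f * g) := fun m => by
  classical
  rw [coeff_mul]
  refine Finset.sum_induction _ (pInt p) (fun _ _ => aux_pInt_add hp) ?_ ?_
  · simpa using aux_pInt_nat hp 0
  · intro x _
    exact aux_pInt_mul hp (hf _) (hg _)

theorem aux_poly_C {p : ℕ} (hp : p.Prime) {c : ℚ} (hc : pInt p c) : polyPInt p (C c) := fun m => by
  classical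
  rw [coeff_C]
  split_ifs
  · exact hc
  · simpa using aux_pInt_nat hp 0

theorem aux_poly_X {p : ℕ} (hp : p.Prime) (i : Fin 3) : polyPInt p (X i) := fun m => by
  classical
  rw [coeff_X]
  split_ifs
  · simpa using aux_pInt_nat hp 1
  · simpa using aux_pInt_nat hp 0

theorem aux_poly_sub {p : ℕ} (hp : p.Prime) {f g : Poly3} (hf : polyPInt p f)
    (hg : polyPInt p g) : polyPInt p (f - g) := by
  have h := aux_poly_add hp hf (aux_poly_mul hp (aux_poly_C hp (aux_pInt_int hp (-1))) hg)
  have e : f - g = f + C ((-1 : ℤ) : ℚ) * g := by simp [sub_eq_add_neg]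
  rwa [e]

theorem aux_poly_pderiv {p : ℕ} (hp : p.Prime) {f : Poly3} (i : Fin 3) (hf : polyPInt p f) :
    polyPInt p (pderiv i f) := fun m => by
  rw [coeff_pderiv]
  have := aux_pInt_nat hp (m i + 1)
  push_cast at this
  exact aux_pInt_mul hp (hf _) this

theorem aux_not_dvd_twelve {p : ℕ} (hp : p.Prime) (hp5 : 5 ≤ p) : ¬ p ∣ 12 := by
  intro h
  have h' : p ∣ 2 ^ 2 * 3 := by simpa using h
  rcases (hp.dvd_mul).1 h' with h | h
  · have := Nat.le_of_dvd (by norm_num) (hp.dvd_of_dvd_pow h); omega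
  · have := Nat.le_of_dvd (by norm_num) h; omega

theorem aux_poly_Dop {p : ℕ} (hp : p.Prime) (hp5 : 5 ≤ p) {f : Poly3} (hf : polyPInt p f) :
    polyPInt p (Dop f) := by
  have h12 := aux_not_dvd_twelve hp hp5
  have c12 : pInt p (1/12 : ℚ) := by simpa using aux_pInt_inv 12 h12
  have c3 : pInt p (1/3 : ℚ) := by
    simpa using aux_pInt_inv 3 (fun h => h12 (h.trans (by norm_num)))
  have c2 : pInt p (1/2 : ℚ) := by
    simpa using aux_pInt_inv 2 (fun h => h12 (h.trans (by norm_num)))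
  have hX := fun i => aux_poly_X hp i
  have sq : ∀ i, polyPInt p (X i ^ 2) := fun i => by
    rw [pow_two]; exact aux_poly_mul hp (hX i) (hX i)
  have hd := fun i => aux_poly_pderiv hp i hf
  unfold Dop
  refine aux_poly_add hp (aux_poly_add hp ?_ ?_) ?_
  · exact aux_poly_mul hp (aux_poly_mul hp (aux_poly_C hp c12) (aux_poly_sub hp (sq _) (hX _))) (hd _)
  · exact aux_poly_mul hp (aux_poly_mul hp (aux_poly_C hp c3)
      (aux_poly_sub hp (aux_poly_mul hp (hX _) (hX _)) (hX _))) (hd _)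
  · exact aux_poly_mul hp (aux_poly_mul hp (aux_poly_C hp c2)
      (aux_poly_sub hp (aux_poly_mul hp (hX _) (hX _)) (sq _))) (hd _)

theorem aux_iso_nat (w : ℕ) (f : Poly3) :
    Isobaric w f ↔ IsWeightedHomogeneous (![2, 4, 6] : Fin 3 → ℕ) f w := by
  unfold Isobaric IsWeightedHomogeneous
  refine forall_congr' fun m => ?_
  rw [mem_support_iff, Finsupp.weight_apply, Finsupp.sum_fintype _ _ (by simp)]
  simp [Fin.sum_univ_three, mul_comm]

theorem aux_iso_int (w : ℕ) (f : Poly3) :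
    Isobaric w f ↔ IsWeightedHomogeneous (![2, 4, 6] : Fin 3 → ℤ) f (w : ℤ) := by
  unfold Isobaric IsWeightedHomogeneous
  refine forall_congr' fun m => ?_
  rw [mem_support_iff, Finsupp.weight_apply, Finsupp.sum_fintype _ _ (by simp)]
  simp only [Fin.sum_univ_three]
  refine imp_congr_right fun _ => ?_
  simp
  omega

theorem aux_iso_Dop (w : ℕ) (f : Poly3) (hf : Isobaric w f) : Isobaric (w + 2) (Dop f) := by
  rw [aux_iso_int] at hf ⊢
  have hX := fun i => isWeightedHomogeneous_X ℚ (![2, 4, 6] : Fin 3 → ℤ) i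
  have h0 : IsWeightedHomogeneous (![2, 4, 6] : Fin 3 → ℤ) (X 0 : Poly3) 2 := hX 0
  have h1 : IsWeightedHomogeneous (![2, 4, 6] : Fin 3 → ℤ) (X 1 : Poly3) 4 := hX 1
  have h2 : IsWeightedHomogeneous (![2, 4, 6] : Fin 3 → ℤ) (X 2 : Poly3) 6 := hX 2
  have d0 : IsWeightedHomogeneous (![2, 4, 6] : Fin 3 → ℤ) (pderiv 0 f) ((w : ℤ) - 2) :=
    hf.pderiv (by simp)
  have d1 : IsWeightedHomogeneous (![2, 4, 6] : Fin 3 → ℤ) (pderiv 1 f) ((w : ℤ) - 4) :=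
    hf.pderiv (by simp)
  have d2 : IsWeightedHomogeneous (![2, 4, 6] : Fin 3 → ℤ) (pderiv 2 f) ((w : ℤ) - 6) :=
    hf.pderiv (by simp)
  have a0 : IsWeightedHomogeneous (![2, 4, 6] : Fin 3 → ℤ) (X 0 ^ 2 - X 1 : Poly3) 4 := by
    rw [sub_eq_add_neg, pow_two]
    exact (h0.mul h0).add h1.neg
  have a1 : IsWeightedHomogeneous (![2, 4, 6] : Fin 3 → ℤ) (X 0 * X 1 - X 2 : Poly3) 6 := by
    rw [sub_eq_add_neg]
    exact (h0.mul h1).add h2.neg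
  have a2 : IsWeightedHomogeneous (![2, 4, 6] : Fin 3 → ℤ) (X 0 * X 2 - X 1 ^ 2 : Poly3) 8 := by
    rw [sub_eq_add_neg, pow_two]
    exact (h0.mul h2).add (h1.mul h1).neg
  have e0 := (a0.C_mul (1/12)).mul d0
  have e1 := (a1.C_mul (1/3)).mul d1
  have e2 := (a2.C_mul (1/2)).mul d2
  rw [show (4 : ℤ) + (w - 2) = ((w + 2 : ℕ) : ℤ) by push_cast; ring] at e0
  rw [show (6 : ℤ) + (w - 4) = ((w + 2 : ℕ) : ℤ) by push_cast; ring] at e1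
  rw [show (8 : ℤ) + (w - 6) = ((w + 2 : ℕ) : ℤ) by push_cast; ring] at e2
  exact (e0.add e1).add e2

theorem aux_pderiv_comm (i j : Fin 3) (f : Poly3) :
    pderiv i (pderiv j f) = pderiv j (pderiv i f) := by
  classical
  ext m
  simp only [coeff_pderiv]
  rw [add_right_comm]
  by_cases h : i = j
  · subst h; rfl
  · have h' : j ≠ i := fun e => h e.symm
    simp [h, h']
    ring

theorem aux_comm (w : ℕ) (f : Poly3) (hf : Isobaric w f) :
    pderiv 0 (Dop f) = Dop (pderiv 0 f) + C ((w : ℚ) / 12) * f := by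
  have E := ((aux_iso_nat w f).1 hf).sum_weight_X_mul_pderiv
  simp [Fin.sum_univ_three] at E
  have hw : C ((w : ℚ) / 12) * f = C (1/12 : ℚ) * ((w : Poly3) * f) := by
    rw [← mul_assoc, div_eq_mul_one_div, mul_comm (w : ℚ), C_mul]; simp
  have e3 : (C (1/3 : ℚ) : Poly3) = C (1/12) * 4 := by
    rw [← map_ofNat (C : ℚ →+* Poly3) 4, ← C_mul]; norm_num
  have e2 : (C (1/2 : ℚ) : Poly3) = C (1/12) * 6 := by
    rw [← map_ofNat (C : ℚ →+* Poly3) 6, ← C_mul]; norm_num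
  rw [hw, ← E]
  unfold Dop
  rw [e3, e2, aux_pderiv_comm 1 0, aux_pderiv_comm 2 0]
  have hc : pderiv 0 (C (1/12 : ℚ) : Poly3) = 0 := pderiv_C
  generalize (C (1/12 : ℚ) : Poly3) = c at *
  have h4 : pderiv 0 (4 : Poly3) = 0 := by
    rw [← map_ofNat (C : ℚ →+* Poly3) 4]; exact pderiv_C
  have h6 : pderiv 0 (6 : Poly3) = 0 := by
    rw [← map_ofNat (C : ℚ →+* Poly3) 6]; exact pderiv_C
  have x1 : pderiv 0 (X 1 : Poly3) = 0 := pderiv_X_of_ne (by decide)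
  have x2 : pderiv 0 (X 2 : Poly3) = 0 := pderiv_X_of_ne (by decide)
  simp only [map_add, map_sub, pderiv_mul, pow_two, hc, h4, h6, x1, x2, pderiv_X_self]
  ring

theorem aux_Dop_C_mul (c : ℚ) (f : Poly3) : Dop (C c * f) = C c * Dop f := by
  simp only [Dop, pderiv_C_mul]; ring

theorem aux_iso_iter (k : ℕ) (F : Poly3) (hF : Isobaric k F) (s : ℕ) :
    Isobaric (k + 2 * s) (Dop^[s] F) := by
  induction s with
  | zero => simpa using hF
  | succ s ih => rw [Function.iterate_succ_apply']; exact aux_iso_Dop _ _ ih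

theorem aux_pderiv_NoP (F : Poly3) (hF : NoP F) : pderiv 0 F = 0 := by
  ext m
  rw [coeff_pderiv, coeff_zero]
  have : coeff (m + Finsupp.single 0 1) F = 0 := by
    by_contra h
    have := hF _ (mem_support_iff.2 h)
    simp at this
  rw [this, zero_mul]

theorem aux_pderiv_iter (k : ℕ) (F : Poly3) (hF : Isobaric k F) (hN : NoP F) (s : ℕ) :
    pderiv 0 (Dop^[s + 1] F) = C (((s + 1) * (k + s) : ℚ) / 12) * Dop^[s] F := by
  induction s with
  | zero =>
    have h0 : Dop (0 : Poly3) = 0 := by simp [Dop]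
    simp [aux_comm k F hF, aux_pderiv_NoP F hN, h0]
  | succ s ih =>
    rw [Function.iterate_succ_apply', aux_comm _ _ (aux_iso_iter k F hF (s + 1)), ih,
      aux_Dop_C_mul, ← Function.iterate_succ_apply' Dop s, ← add_mul, ← C_add]
    congr 2
    push_cast
    ring

theorem aux_coeff_iter (k : ℕ) (F : Poly3) (hF : Isobaric k F) (hN : NoP F) (s : ℕ)
    (m : Fin 3 →₀ ℕ) (hm : m 0 ≠ 0) :
    coeff m (Dop^[s + 1] F) * (m 0 : ℚ) =
      ((s + 1) * (k + s) : ℚ) / 12 * coeff (m - Finsupp.single 0 1) (Dop^[s] F) := by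
  have h := congrArg (coeff (m - Finsupp.single 0 1)) (aux_pderiv_iter k F hF hN s)
  have e : m - Finsupp.single 0 1 + Finsupp.single 0 1 = m :=
    Finsupp.sub_add_single_one_cancel hm
  rw [coeff_pderiv, e, coeff_C_mul] at h
  rw [← h]
  have : (m 0 : ℚ) = (((m - Finsupp.single 0 1 : Fin 3 →₀ ℕ) 0 + 1 : ℕ) : ℚ) := by
    congr 1; simp; omega
  rw [this]; push_cast; rfl

theorem aux_deg_iter (k : ℕ) (F : Poly3) (hF : Isobaric k F) (hN : NoP F) (s : ℕ) :
    ∀ m : Fin 3 →₀ ℕ, s < m 0 → coeff m (Dop^[s] F) = 0 := by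
  induction s with
  | zero =>
    intro m hm
    by_contra h
    have := hN m (mem_support_iff.2 h)
    omega
  | succ s ih =>
    intro m hm
    have h := aux_coeff_iter k F hF hN s m (by omega)
    rw [ih _ (by simp; omega), mul_zero] at h
    rcases mul_eq_zero.1 h with h | h
    · exact h
    · have : m 0 = 0 := by exact_mod_cast h
      omega

theorem aux_int_iter {p : ℕ} (hp : p.Prime) (hp5 : 5 ≤ p) (F : Poly3) (hF : polyPInt p F)
    (s : ℕ) : polyPInt p (Dop^[s] F) := by
  induction s with
  | zero => simpa using hF
  | succ s ih => rw [Function.iterate_succ_apply']; exact aux_poly_Dop hp hp5 ih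

/-- The key congruence: coefficients involving `P` are divisible by `p`. -/
theorem aux_key {p : ℕ} (hp : p.Prime) (hp5 : 5 ≤ p) (k n s : ℕ) (F : Poly3)
    (hF : Isobaric k F) (hN : NoP F) (hI : polyPInt p F) (hs : s + k = n * p + 1) (hsp : s < p)
    (m : Fin 3 →₀ ℕ) (hm : m 0 ≠ 0) : pInt p ((p : ℚ)⁻¹ * coeff m (Dop^[s] F)) := by
  by_cases hlt : s < m 0
  · rw [aux_deg_iter k F hF hN s m hlt, mul_zero]
    simpa using aux_pInt_nat hp 0
  · obtain ⟨t, rfl⟩ : ∃ t, s = t + 1 := ⟨s - 1, by omega⟩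
    have h := aux_coeff_iter k F hF hN t m hm
    have hkt : (k : ℚ) + t = n * p := by
      have : k + t = n * p := by omega
      exact_mod_cast this
    have hp0 : (p : ℚ) ≠ 0 := by exact_mod_cast hp.ne_zero
    have hm0 : (m 0 : ℚ) ≠ 0 := by exact_mod_cast hm
    have e : (p : ℚ)⁻¹ * coeff m (Dop^[t + 1] F) =
        ((((t + 1) * n : ℕ) : ℚ) * ((12 : ℕ) : ℚ)⁻¹) * ((m 0 : ℕ) : ℚ)⁻¹ *
          coeff (m - Finsupp.single 0 1) (Dop^[t] F) := by
      rw [hkt] at h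
      rw [eq_div_of_mul_eq hm0 h]
      push_cast
      field_simp
    rw [e]
    refine aux_pInt_mul hp (aux_pInt_mul hp (aux_pInt_mul hp (aux_pInt_nat hp _)
      (aux_pInt_inv 12 (aux_not_dvd_twelve hp hp5))) (aux_pInt_inv _ ?_))
      (aux_int_iter hp hp5 F hI t _)
    intro hd
    have := Nat.le_of_dvd (by omega) hd
    omega

theorem stmt_3 (p : ℕ) (hp : p.Prime) (hp5 : 5 ≤ p)
    (k : ℕ) (hk : 0 < k) (F : Poly3) (hFiso : Isobaric k F) (hFnoP : NoP F)
    (hFint : polyPInt p F)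
    (n : ℕ) (hn1 : (k : ℤ) ≤ n * p + 1) (hn2 : (n * p + 1 : ℤ) - k < p) :
    ∃ G H : Poly3, Isobaric (2 * n * p + 2 - k) G ∧ NoP G ∧ polyPInt p G ∧
      polyPInt p H ∧ Dop^[n * p + 1 - k] F - G = (p : Poly3) * H := by
  classical
  have hn1' : k ≤ n * p + 1 := by exact_mod_cast hn1
  obtain ⟨s, hs⟩ : ∃ s, s = n * p + 1 - k := ⟨_, rfl⟩
  have hsk : s + k = n * p + 1 := by omega
  have hsp : s < p := by
    have : (s : ℤ) + k = n * p + 1 := by exact_mod_cast hsk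
    omega
  rw [← hs]
  have hw : 2 * n * p + 2 - k = k + 2 * s := by
    have : 2 * n * p = 2 * (n * p) := by ring
    omega
  rw [hw]
  set f := Dop^[s] F with hf
  have hp0 : (p : ℚ) ≠ 0 := by exact_mod_cast hp.ne_zero
  obtain ⟨G, hG⟩ : ∃ G : Poly3, ∀ m, coeff m G = if m 0 = 0 then coeff m f else 0 := by
    refine ⟨∑ m ∈ f.support.filter (fun m => m 0 = 0), monomial m (coeff m f), fun m => ?_⟩
    simp only [coeff_sum, coeff_monomial, Finset.sum_ite_eq', Finset.mem_filter, mem_support_iff]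
    by_cases h : m 0 = 0 <;> by_cases h2 : coeff m f = 0 <;> simp [h, h2]
  have hGs : ∀ m ∈ G.support, m 0 = 0 ∧ m ∈ f.support := by
    intro m hm
    rw [mem_support_iff, hG] at hm
    by_cases h : m 0 = 0
    · rw [if_pos h] at hm
      exact ⟨h, mem_support_iff.2 hm⟩
    · rw [if_neg h] at hm
      exact absurd rfl hm
  refine ⟨G, C ((p : ℚ)⁻¹) * (f - G), ?_, ?_, ?_, ?_, ?_⟩
  · exact fun m hm => aux_iso_iter k F hFiso s m (hGs m hm).2
  · exact fun m hm => (hGs m hm).1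
  · intro m
    rw [hG]
    split_ifs
    · exact aux_int_iter hp hp5 F hFint s m
    · simpa using aux_pInt_nat hp 0
  · intro m
    rw [coeff_C_mul, coeff_sub, hG]
    split_ifs with h
    · simpa using aux_pInt_nat hp 0
    · rw [sub_zero]
      exact aux_key hp hp5 k n s F hFiso hFnoP hFint hsk hsp m h
  · have : (p : Poly3) = C (p : ℚ) := by simp
    rw [this, ← mul_assoc, ← C_mul, mul_inv_cancel₀ hp0, C_1, one_mul]
end
end

section
/- Let p ≥ 5 be a prime and let A ∈ ℤ_(p)[Q,R] be the polynomial expressing the Eisenstein series E_{p−1} in Q and R. Then D²A ≡ 0 (mod p); that is, every coefficient of the polynomial D²A ∈ ℤ_(p)[P,Q,R] lies in p·ℤ_(p). -/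
open MvPolynomial Finset

noncomputable section

section Modular
open UpperHalfPlane hiding I
open Real Complex
open scoped Manifold MatrixGroups ModularForm Topology
open Derivative ModularForm ModularFormClass EisensteinSeries Function

/-- holomorphic, 1-periodic, bounded at infinity -/
structure GoodF (f : ℍ → ℂ) : Prop where
  per : Periodic (f ∘ ofComplex) ((1 : ℝ) : ℂ)
  hol : MDiff f
  bdd : IsBoundedAtImInfty f

lemma GoodF.an {f : ℍ → ℂ} (h : GoodF f) : AnalyticAt ℂ (cuspFunction 1 f) 0 :=
  analyticAt_cuspFunction_zero one_pos h.per h.hol h.bdd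

lemma GoodF.mul {f g : ℍ → ℂ} (hf : GoodF f) (hg : GoodF g) : GoodF (f * g) where
  per := by
    have := hf.per.mul hg.per
    exact this
  hol := hf.hol.mul hg.hol
  bdd := hf.bdd.mul hg.bdd

lemma GoodF.add {f g : ℍ → ℂ} (hf : GoodF f) (hg : GoodF g) : GoodF (f + g) where
  per := by
    have := hf.per.add hg.per
    exact this
  hol := hf.hol.add hg.hol
  bdd := hf.bdd.add hg.bdd

lemma GoodF.smul {f : ℍ → ℂ} (c : ℂ) (hf : GoodF f) : GoodF (c • f) where
  per := by
    intro z
    have := hf.per z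
    simp only [Function.comp_apply, Pi.smul_apply] at this ⊢
    rw [this]
  hol := hf.hol.const_smul c
  bdd := hf.bdd.const_smul_left c

lemma GoodF.ofForm {k : ℤ} (f : ModularForm 𝒮ℒ k) : GoodF f where
  per := SlashInvariantFormClass.periodic_comp_ofComplex f one_mem_strictPeriods_SL
  hol := holo f
  bdd := bdd_at_infty f

lemma hasSum_E2' (z : ℍ) : HasSum (fun m : ℕ ↦ (if m = 0 then 1 else -24 * ArithmeticFunction.sigma 1 m : ℂ) • 
    Periodic.qParam 1 z ^ m) (E2 z) := by
  simpa only [Function.Periodic.qParam, ofReal_one, div_one] using hasSum_qExpansion_E2 (z := z)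

lemma per_of_hasSum {f : ℍ → ℂ} {c : ℕ → ℂ}
    (h : ∀ z : ℍ, HasSum (fun m : ℕ ↦ c m • Periodic.qParam 1 z ^ m) (f z)) :
    Periodic (f ∘ ofComplex) ((1 : ℝ) : ℂ) := by
  intro w
  by_cases hw : 0 < im w
  · have hw' : 0 < im (w + (1:ℝ)) := by simpa using hw
    have h1 := h (⟨w, hw⟩ : ℍ)
    have h2 := h (⟨w + (1:ℝ), hw'⟩ : ℍ)
    simp only [Function.comp_apply, ofComplex_apply_of_im_pos hw, ofComplex_apply_of_im_pos hw']
    refine h2.unique ?_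
    convert h1 using 4
    change Periodic.qParam 1 (w + (1:ℝ)) = Periodic.qParam 1 w
    simp only [Periodic.qParam, ofReal_one, div_one, mul_add, mul_one]
    exact Complex.exp_periodic _
  · have hw' : im (w + (1:ℝ)) ≤ 0 := by simpa using hw
    simp only [Function.comp_apply, ofComplex_apply_of_im_nonpos (not_lt.mp hw),
      ofComplex_apply_of_im_nonpos hw']

lemma GoodF.E2 : GoodF E2 where
  per := per_of_hasSum hasSum_E2'
  hol := E2_mdifferentiable
  bdd := isBoundedAtImInfty_E2

lemma GoodF.coeff_unique {f : ℍ → ℂ} (hg : GoodF f) {c : ℕ → ℂ}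
    (h : ∀ z : ℍ, HasSum (fun m : ℕ ↦ c m • Periodic.qParam 1 z ^ m) (f z)) (m : ℕ) :
    (qExpansion 1 f).coeff m = c m := by
  have h1 := (hasFPowerSeriesOnBall_cuspFunction one_pos hg.an h).hasFPowerSeriesAt
  have h2 := (hasFPowerSeriesOnBall_cuspFunction one_pos hg.an
    (hasSum_qExpansion one_pos hg.per hg.hol hg.bdd)).hasFPowerSeriesAt
  have := congr_arg (FormalMultilinearSeries.coeff · m) (h1.eq_formalMultilinearSeries h2)
  simpa using this.symm

lemma qExp_E2 (m : ℕ) :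
    (qExpansion 1 E2).coeff m = (if m = 0 then 1 else -24 * ArithmeticFunction.sigma 1 m : ℂ) :=
  GoodF.E2.coeff_unique hasSum_E2' m

lemma hasSum_congr_of_eq {f g : ℕ → ℂ} {a : ℂ} (h : HasSum f a) (e : ∀ n, g n = f n) : HasSum g a := by
  rwa [show g = f from funext e]

lemma GoodF.hasSum_D {f : ℍ → ℂ} (h : GoodF f) (z : ℍ) :
    HasSum (fun m : ℕ ↦ ((m : ℂ) * (qExpansion 1 f).coeff m) • Periodic.qParam 1 z ^ m)
      (normalizedDerivOfComplex f z) := by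
  have hd := differentiableOn_cuspFunction_ball one_pos h.per h.hol h.bdd
  have hd' := hd.deriv Metric.isOpen_ball
  set q := Periodic.qParam 1 (z : ℂ) with hq
  have hq1 : ‖q‖ < 1 := Periodic.norm_qParam_lt_one one_pos z.im_pos
  have hqm : q ∈ Metric.ball (0 : ℂ) 1 := by simpa using hq1
  have hT := Complex.hasSum_taylorSeries_on_ball hd' hqm
  have hval : normalizedDerivOfComplex f z = q * deriv (cuspFunction 1 f) q := by
    have heq : (f ∘ ofComplex) =ᶠ[𝓝 (z : ℂ)] (cuspFunction 1 f ∘ Periodic.qParam 1) := by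
      filter_upwards with w
      exact (Periodic.eq_cuspFunction one_ne_zero h.per w).symm
    have h1 : HasDerivAt (Periodic.qParam 1) (q * (2 * π * I)) (z : ℂ) := by
      have : HasDerivAt (fun w : ℂ => 2 * π * I * w / ((1:ℝ) : ℂ)) (2 * π * I) (z : ℂ) := by
        simpa using (hasDerivAt_id (z : ℂ)).const_mul (2 * π * I)
      exact this.cexp
    have h2 : HasDerivAt (cuspFunction 1 f) (deriv (cuspFunction 1 f) q) (Periodic.qParam 1 (z : ℂ)) :=
      ((hd q hqm).differentiableAt (Metric.isOpen_ball.mem_nhds hqm)).hasDerivAt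
    have h3 := h2.comp (z : ℂ) h1
    rw [normalizedDerivOfComplex, heq.deriv_eq, h3.deriv]
    field_simp
  rw [hval, ← hasSum_nat_add_iff' 1]
  simp only [Finset.range_one, Finset.sum_singleton, Nat.cast_zero, zero_mul, zero_smul, sub_zero]
  refine hasSum_congr_of_eq (hT.mul_left q) fun m => ?_
  rw [qExpansion_coeff, iteratedDeriv_succ', Nat.factorial_succ]
  have : ((m.factorial : ℕ) : ℂ) ≠ 0 := by exact_mod_cast m.factorial_ne_zero
  have : ((m : ℂ) + 1) ≠ 0 := by exact_mod_cast m.succ_ne_zero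
  push_cast
  simp only [smul_eq_mul, sub_zero]
  field_simp
  ring

lemma GoodF.D {f : ℍ → ℂ} (h : GoodF f) : GoodF (normalizedDerivOfComplex f) where
  per := per_of_hasSum h.hasSum_D
  hol := normalizedDerivOfComplex_mdifferentiable h.hol
  bdd := isBoundedAtImInfty_of_hasSum_qExpansion one_pos h.hasSum_D

lemma GoodF.qExp_D {f : ℍ → ℂ} (h : GoodF f) (m : ℕ) :
    (qExpansion 1 (normalizedDerivOfComplex f)).coeff m = m * (qExpansion 1 f).coeff m :=
  h.D.coeff_unique h.hasSum_D m

lemma GoodF.eq_zero {f : ℍ → ℂ} (h : GoodF f) {k : ℤ} (hk : k < 12)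
    (hf : ∀ γ : SL(2, ℤ), f ∣[k] γ = f) (h0 : (qExpansion 1 f).coeff 0 = 0) : f = 0 := by
  let F : ModularForm 𝒮ℒ k := 
    { toFun := f
      slash_action_eq' := fun _ ⟨γ, hγ⟩ ↦ hγ ▸ hf γ
      holo' := h.hol
      bdd_at_cusps' {c} hc := by
        rw [Subgroup.IsArithmetic.isCusp_iff_isCusp_SL2Z] at hc
        rw [OnePoint.isBoundedAt_iff_forall_SL2Z hc]
        intro γ _
        rw [hf γ]
        exact h.bdd }
  have : F = 0 := by
    apply sturm_bound_levelOne
    have : k.toNat / 12 = 0 := by omega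
    rw [this]
    rw [Nat.cast_zero, pos_iff_ne_zero]
    apply PowerSeries.order_ne_zero_iff_constCoeff_eq_zero.mpr
    rw [← PowerSeries.coeff_zero_eq_constantCoeff_apply]
    exact h0
  exact congrArg (fun G : ModularForm 𝒮ℒ k => (G : ℍ → ℂ)) this

lemma DD2S_hasDerivAt (z : ℍ) : HasDerivAt ((D2 ModularGroup.S) ∘ ofComplex)
    (-(2 * π * I) / (z : ℂ) ^ 2) (z : ℂ) := by
  have h1 : HasDerivAt (fun w : ℂ => 2 * π * I * w⁻¹) (2 * π * I * (-((z : ℂ) ^ 2)⁻¹)) (z : ℂ) :=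
    (hasDerivAt_inv z.ne_zero).const_mul _
  have h2 : ((D2 ModularGroup.S) ∘ ofComplex) =ᶠ[𝓝 (z : ℂ)] (fun w : ℂ => 2 * π * I * w⁻¹) := by
    filter_upwards [isOpen_upperHalfPlaneSet.mem_nhds z.im_pos] with w hw
    simp only [Function.comp_apply, D2_S, ofComplex_apply_of_im_pos hw]
    rfl
  have e : -(2 * π * I) / (z : ℂ) ^ 2 = 2 * π * I * (-((z : ℂ) ^ 2)⁻¹) := by ring
  rw [e]
  exact h1.congr_of_eventuallyEq h2

lemma D2S_mdiff : MDiff (D2 ModularGroup.S) := fun z =>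
  UpperHalfPlane.mdifferentiableAt_iff.mpr (DD2S_hasDerivAt z).differentiableAt

lemma D_D2S : normalizedDerivOfComplex (D2 ModularGroup.S) =
    fun z => (4 * (π : ℂ) ^ 2)⁻¹ * (D2 ModularGroup.S z) ^ 2 := by
  ext z
  rw [normalizedDerivOfComplex, (DD2S_hasDerivAt z).deriv, D2_S]
  have := z.ne_zero
  have hpi : (π : ℂ) ≠ 0 := by exact_mod_cast Real.pi_ne_zero
  field_simp
  rw [I_sq]
  norm_num

/-- The weight 4 form `DE₂ - E₂²/12`. -/
def F4 : ℍ → ℂ := normalizedDerivOfComplex E2 + (-(12:ℂ)⁻¹) • (E2 * E2)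

lemma F4_slash_aux (γ : SL(2, ℤ)) (hm : MDiff (D2 γ)) (hD : normalizedDerivOfComplex (D2 γ) =
    fun z => (4 * (π : ℂ) ^ 2)⁻¹ * (D2 γ z) ^ 2) : F4 ∣[(4 : ℤ)] γ = F4 := by
  have hF : F4 = serreDerivative 2 E2 + (12:ℂ)⁻¹ • (E2 * E2) := by
    ext z
    simp [F4]
    ring
  have h1 : serreDerivative 2 E2 ∣[(4:ℤ)] γ = serreDerivative 2 (E2 ∣[(2:ℤ)] γ) := by
    have := serreDerivative_slash_equivariant (k := 2) E2_mdifferentiable (γ := γ)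
    exact_mod_cast this
  have h2 := ModularForm.mul_slash_SL2 2 2 γ E2 E2
  have h3 := E2_slash_action γ
  have h4 : serreDerivative 2 (E2 ∣[(2:ℤ)] γ) = 
    serreDerivative 2 E2 - (1 / (2 * riemannZeta 2)) • serreDerivative 2 (D2 γ) := by
    rw [h3, serreDerivative_sub _ _ _ E2_mdifferentiable (hm.const_smul _), serreDerivative_smul _ _ _ hm]
  rw [hF, SlashAction.add_slash, ModularForm.SL_smul_slash]
  norm_num at h2
  rw [h1, h4, h2, h3]
  ext z
  have h5 := congrFun hD z
  have hpi : (π : ℂ) ≠ 0 := by exact_mod_cast Real.pi_ne_zero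
  simp only [Pi.add_apply, Pi.sub_apply, Pi.smul_apply, Pi.mul_apply, smul_eq_mul, serreDerivative, h5,
    riemannZeta_two]
  field_simp
  ring

lemma F4_slash (γ : SL(2, ℤ)) : F4 ∣[(4 : ℤ)] γ = F4 := by
  apply SlashInvariantForm.slash_action_generators_SL2Z
  · exact F4_slash_aux _ D2S_mdiff D_D2S
  · apply F4_slash_aux
    · rw [D2_T]; exact mdifferentiable_const
    · rw [D2_T]
      ext z
      have := normalizedDerivOfComplex_const 0
      have h := congrFun this z
      simp only [Pi.zero_apply, ne_eq, OfNat.ofNat_ne_zero, not_false_eq_true, zero_pow, mul_zero]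
      exact h

lemma serre_slash {k : ℤ} (f : ModularForm 𝒮ℒ k) (γ : SL(2, ℤ)) :
    serreDerivative k f ∣[k + 2] γ = serreDerivative k f :=
  serreDerivative_slash_invariant (holo f) (f.slash_action_eq' (γ : GL (Fin 2) ℝ) ⟨γ, rfl⟩)


lemma GoodF.qexp_add {f g : ℍ → ℂ} (hf : GoodF f) (hg : GoodF g) :
    qExpansion 1 (f + g) = qExpansion 1 f + qExpansion 1 g := qExpansion_add hf.an hg.an

lemma GoodF.qexp_mul {f g : ℍ → ℂ} (hf : GoodF f) (hg : GoodF g) :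
    qExpansion 1 (f * g) = qExpansion 1 f * qExpansion 1 g := qExpansion_mul hf.an hg.an

lemma GoodF.qexp_smul {f : ℍ → ℂ} (c : ℂ) (hf : GoodF f) :
    qExpansion 1 (c • f) = c • qExpansion 1 f := qExpansion_smul hf.an c

/-- the theta operator on power series -/
def thS {S : Type*} [CommRing S] (f : PowerSeries S) : PowerSeries S :=
  PowerSeries.X * PowerSeries.derivative S f

lemma coeff_thS {S : Type*} [CommRing S] (f : PowerSeries S) (n : ℕ) :
    PowerSeries.coeff n (thS f) = n * PowerSeries.coeff n f := by
  rcases n with _ | n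
  · simp [thS]
  · rw [thS, PowerSeries.coeff_succ_X_mul, PowerSeries.coeff_derivative]
    push_cast
    ring

lemma GoodF.qexp_D {f : ℍ → ℂ} (hf : GoodF f) :
    qExpansion 1 (normalizedDerivOfComplex f) = thS (qExpansion 1 f) := by
  ext n
  rw [hf.qExp_D, coeff_thS]

lemma qE4 (m : ℕ) : (qExpansion 1 E₄).coeff m =
    (if m = 0 then 1 else 240 * ArithmeticFunction.sigma 3 m : ℂ) := by
  have := EisensteinSeries.E_qExpansion_coeff (k := 4) (by norm_num) (by decide) m
  rw [show bernoulli 4 = -1/30 by decide +kernel] at this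
  rw [show (E₄ : ModularForm 𝒮ℒ 4) = E (by norm_num : 3 ≤ 4) from rfl, this]
  norm_num

lemma qE6 (m : ℕ) : (qExpansion 1 E₆).coeff m =
    (if m = 0 then 1 else -504 * ArithmeticFunction.sigma 5 m : ℂ) := by
  have := EisensteinSeries.E_qExpansion_coeff (k := 6) (by norm_num) (by decide) m
  rw [show bernoulli 6 = 1/42 by decide +kernel] at this
  rw [show (E₆ : ModularForm 𝒮ℒ 6) = E (by norm_num : 3 ≤ 6) from rfl, this]
  norm_num

lemma E4_slash (γ : SL(2, ℤ)) : (E₄ : ℍ → ℂ) ∣[(4:ℤ)] γ = E₄ :=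
  E₄.slash_action_eq' (γ : GL (Fin 2) ℝ) ⟨γ, rfl⟩

lemma E6_slash (γ : SL(2, ℤ)) : (E₆ : ℍ → ℂ) ∣[(6:ℤ)] γ = E₆ :=
  E₆.slash_action_eq' (γ : GL (Fin 2) ℝ) ⟨γ, rfl⟩

lemma ramC2 : (12 : PowerSeries ℂ) * thS (qExpansion 1 E2) =
    qExpansion 1 E2 ^ 2 - qExpansion 1 E₄ := by
  have g2 := GoodF.E2
  have g4 := GoodF.ofForm E₄
  have gF : GoodF F4 := g2.D.add ((g2.mul g2).smul _)
  have g := gF.add (g4.smul ((12:ℂ)⁻¹))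
  have hq : qExpansion 1 (F4 + (12:ℂ)⁻¹ • (E₄ : ℍ → ℂ)) = thS (qExpansion 1 E2) +
      (-(12:ℂ)⁻¹) • (qExpansion 1 E2 * qExpansion 1 E2) + (12:ℂ)⁻¹ • qExpansion 1 E₄ := by
    rw [gF.qexp_add (g4.smul _), g4.qexp_smul, F4, g2.D.qexp_add ((g2.mul g2).smul _),
      (g2.mul g2).qexp_smul, g2.qexp_mul g2, g2.qexp_D]
  have h0 := g.eq_zero (k := 4) (by norm_num) (fun γ => by
    rw [SlashAction.add_slash, ModularForm.SL_smul_slash, F4_slash, E4_slash]) (by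
    rw [hq]
    simp only [map_add, coeff_thS, PowerSeries.coeff_smul, PowerSeries.coeff_mul, qExp_E2, qE4]
    simp)
  rw [h0, qExpansion_zero] at hq
  have h12 : (12 : PowerSeries ℂ) = PowerSeries.C 12 := (map_ofNat PowerSeries.C _).symm
  have hc : PowerSeries.C (12:ℂ) * PowerSeries.C (12:ℂ)⁻¹ = 1 := by rw [← map_mul]; simp
  simp only [PowerSeries.smul_eq_C_mul, map_neg] at hq
  rw [h12]
  linear_combination (-PowerSeries.C (12:ℂ)) * hq + (qExpansion 1 E2 ^ 2 - qExpansion 1 E₄) * hc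

lemma serre_eq (k : ℂ) (f : ℍ → ℂ) : serreDerivative k f =
    normalizedDerivOfComplex f + (-(k * 12⁻¹)) • (E2 * f) := by
  ext z
  simp
  ring

lemma ramC4 : (3 : PowerSeries ℂ) * thS (qExpansion 1 E₄) =
    qExpansion 1 E2 * qExpansion 1 E₄ - qExpansion 1 E₆ := by
  have g2 := GoodF.E2
  have g4 := GoodF.ofForm E₄
  have g6 := GoodF.ofForm E₆
  have gF : GoodF (serreDerivative (4:ℤ) E₄) := by
    rw [serre_eq]
    exact g4.D.add ((g2.mul g4).smul _)
  have g := gF.add (g6.smul ((3:ℂ)⁻¹))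
  have hq : qExpansion 1 (serreDerivative (4:ℤ) E₄ + (3:ℂ)⁻¹ • (E₆ : ℍ → ℂ)) = thS (qExpansion 1 E₄) +
      (-(3:ℂ)⁻¹) • (qExpansion 1 E2 * qExpansion 1 E₄) + (3:ℂ)⁻¹ • qExpansion 1 E₆ := by
    rw [gF.qexp_add (g6.smul _), g6.qexp_smul, serre_eq, g4.D.qexp_add ((g2.mul g4).smul _),
      (g2.mul g4).qexp_smul, g2.qexp_mul g4, g4.qexp_D]
    norm_num
  have h0 := g.eq_zero (k := 6) (by norm_num) (fun γ => by
    have := serre_slash E₄ γ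
    rw [show (4:ℤ) + 2 = 6 by norm_num] at this
    rw [SlashAction.add_slash, ModularForm.SL_smul_slash, E6_slash, this]) (by
    rw [hq]
    simp only [map_add, coeff_thS, PowerSeries.coeff_smul, PowerSeries.coeff_mul, qExp_E2, qE4, qE6]
    simp)
  rw [h0, qExpansion_zero] at hq
  have h12 : (3 : PowerSeries ℂ) = PowerSeries.C 3 := (map_ofNat PowerSeries.C _).symm
  have hc : PowerSeries.C (3:ℂ) * PowerSeries.C (3:ℂ)⁻¹ = 1 := by rw [← map_mul]; simp
  simp only [PowerSeries.smul_eq_C_mul, map_neg] at hq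
  rw [h12]
  linear_combination (-PowerSeries.C (3:ℂ)) * hq +
    (qExpansion 1 E2 * qExpansion 1 E₄ - qExpansion 1 E₆) * hc

lemma ramC6 : (2 : PowerSeries ℂ) * thS (qExpansion 1 E₆) =
    qExpansion 1 E2 * qExpansion 1 E₆ - qExpansion 1 E₄ ^ 2 := by
  have g2 := GoodF.E2
  have g4 := GoodF.ofForm E₄
  have g6 := GoodF.ofForm E₆
  have gF : GoodF (serreDerivative (6:ℤ) E₆) := by
    rw [serre_eq]
    exact g6.D.add ((g2.mul g6).smul _)
  have g := gF.add ((g4.mul g4).smul ((2:ℂ)⁻¹))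
  have hq : qExpansion 1 (serreDerivative (6:ℤ) E₆ + (2:ℂ)⁻¹ • ((E₄ : ℍ → ℂ) * E₄)) =
      thS (qExpansion 1 E₆) + (-(2:ℂ)⁻¹) • (qExpansion 1 E2 * qExpansion 1 E₆) +
        (2:ℂ)⁻¹ • (qExpansion 1 E₄ * qExpansion 1 E₄) := by
    rw [gF.qexp_add ((g4.mul g4).smul _), (g4.mul g4).qexp_smul, g4.qexp_mul g4, serre_eq,
      g6.D.qexp_add ((g2.mul g6).smul _), (g2.mul g6).qexp_smul, g2.qexp_mul g6, g6.qexp_D]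
    norm_num
  have h0 := g.eq_zero (k := 8) (by norm_num) (fun γ => by
    have := serre_slash E₆ γ
    rw [show (6:ℤ) + 2 = 8 by norm_num] at this
    have h2 := ModularForm.mul_slash_SL2 4 4 γ E₄ E₄
    rw [show (4:ℤ) + 4 = 8 by norm_num, E4_slash] at h2
    rw [SlashAction.add_slash, ModularForm.SL_smul_slash, h2, this]) (by
    rw [hq]
    simp only [map_add, coeff_thS, PowerSeries.coeff_smul, PowerSeries.coeff_mul, qExp_E2, qE4, qE6]
    simp)
  rw [h0, qExpansion_zero] at hq
  have h12 : (2 : PowerSeries ℂ) = PowerSeries.C 2 := (map_ofNat PowerSeries.C _).symm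
  have hc : PowerSeries.C (2:ℂ) * PowerSeries.C (2:ℂ)⁻¹ = 1 := by rw [← map_mul]; simp
  simp only [PowerSeries.smul_eq_C_mul, map_neg] at hq
  rw [h12]
  linear_combination (-PowerSeries.C (2:ℂ)) * hq +
    (qExpansion 1 E2 * qExpansion 1 E₆ - qExpansion 1 E₄ ^ 2) * hc

/-- integral q-expansions -/
def e2Z : PowerSeries ℤ := PowerSeries.mk fun n => if n = 0 then 1 else -24 * (ArithmeticFunction.sigma 1 n : ℕ)
def e4Z : PowerSeries ℤ := PowerSeries.mk fun n => if n = 0 then 1 else 240 * (ArithmeticFunction.sigma 3 n : ℕ)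
def e6Z : PowerSeries ℤ := PowerSeries.mk fun n => if n = 0 then 1 else -504 * (ArithmeticFunction.sigma 5 n : ℕ)

lemma map_e2Z : PowerSeries.map (Int.castRingHom ℂ) e2Z = qExpansion 1 E2 := by
  ext n
  rw [qExp_E2, PowerSeries.coeff_map, e2Z, PowerSeries.coeff_mk]
  split_ifs <;> simp

lemma map_e4Z : PowerSeries.map (Int.castRingHom ℂ) e4Z = qExpansion 1 E₄ := by
  ext n
  rw [qE4, PowerSeries.coeff_map, e4Z, PowerSeries.coeff_mk]
  split_ifs <;> simp

lemma map_e6Z : PowerSeries.map (Int.castRingHom ℂ) e6Z = qExpansion 1 E₆ := by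
  ext n
  rw [qE6, PowerSeries.coeff_map, e6Z, PowerSeries.coeff_mk]
  split_ifs <;> simp

lemma map_thS {S T : Type*} [CommRing S] [CommRing T] (φ : S →+* T) (f : PowerSeries S) :
    PowerSeries.map φ (thS f) = thS (PowerSeries.map φ f) := by
  ext n
  simp [coeff_thS]

lemma mapZC_inj : Function.Injective (PowerSeries.map (Int.castRingHom ℂ)) :=
  PowerSeries.map_injective _ (RingHom.injective_int _)

lemma ramZ2 : 12 * thS e2Z = e2Z ^ 2 - e4Z := by
  apply mapZC_inj
  simpa only [map_mul, map_sub, map_pow, map_ofNat, map_thS, map_e2Z, map_e4Z] using ramC2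

lemma ramZ4 : 3 * thS e4Z = e2Z * e4Z - e6Z := by
  apply mapZC_inj
  simpa only [map_mul, map_sub, map_pow, map_ofNat, map_thS, map_e2Z, map_e4Z, map_e6Z] using ramC4

lemma ramZ6 : 2 * thS e6Z = e2Z * e6Z - e4Z ^ 2 := by
  apply mapZC_inj
  simpa only [map_mul, map_sub, map_pow, map_ofNat, map_thS, map_e2Z, map_e4Z, map_e6Z] using ramC6

end Modular

lemma transc {K : Type*} [Field K] (τ : PowerSeries K) (h1 : PowerSeries.constantCoeff τ = 1) (hne : τ ≠ 1)
    (G : Polynomial K) (hG : Polynomial.aeval τ G = 0) : G = 0 := by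
  by_contra h
  obtain ⟨H, hH, hd⟩ := Polynomial.exists_eq_pow_rootMultiplicity_mul_and_not_dvd G h 1
  rw [hH, map_mul, map_pow, map_sub, Polynomial.aeval_X, Polynomial.aeval_C, map_one] at hG
  have h2 : Polynomial.aeval τ H = 0 := by
    rcases mul_eq_zero.mp hG with h | h
    · exact absurd (sub_eq_zero.mp (eq_zero_of_pow_eq_zero h)) hne
    · exact h
  apply hd
  rw [Polynomial.dvd_iff_isRoot, Polynomial.IsRoot.def]
  have h3 := congrArg PowerSeries.constantCoeff h2
  rw [Polynomial.aeval_def, Polynomial.hom_eval₂, h1, map_zero] at h3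
  have h4 : (PowerSeries.constantCoeff (R := K)).comp (algebraMap K (PowerSeries K)) = RingHom.id K := by
    ext a
    simp
  rw [h4] at h3
  exact h3

/-- no `P`, weight `n` -/
def Cond {S : Type*} [CommRing S] (n : ℕ) (f : MvPolynomial (Fin 3) S) : Prop :=
  ∀ m, coeff m f ≠ 0 → m 0 = 0 ∧ 4 * m 1 + 6 * m 2 = n

lemma inj_qexp {K : Type*} [Field K] (t u v : PowerSeries K) (hu : PowerSeries.constantCoeff u = 1)
    (hv : PowerSeries.constantCoeff v = 1) (hne : u ^ 3 ≠ v ^ 2) {n : ℕ} (g : MvPolynomial (Fin 3) K)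
    (hg : Cond n g) (h0 : aeval ![t, u, v] g = 0) : g = 0 := by
  have hu' : u * u⁻¹ = 1 := PowerSeries.mul_inv_cancel u (by rw [hu]; exact one_ne_zero)
  have hv' : v * v⁻¹ = 1 := PowerSeries.mul_inv_cancel v (by rw [hv]; exact one_ne_zero)
  set x := v * u⁻¹ with hx
  set τ := u ^ 3 * v⁻¹ ^ 2 with hτ
  have e4 : u = x ^ 2 * τ := by
    calc u = (v * v⁻¹) ^ 2 * ((u * u⁻¹) ^ 2 * u) := by rw [hu', hv']; ring
      _ = _ := by rw [hx, hτ]; ring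
  have e6 : v = x ^ 3 * τ := by
    calc v = (v * v⁻¹) ^ 2 * ((u * u⁻¹) ^ 3 * v) := by rw [hu', hv']; ring
      _ = _ := by rw [hx, hτ]; ring
  have hτ1 : PowerSeries.constantCoeff τ = 1 := by
    simp [hτ, hu, hv]
  have hτne : τ ≠ 1 := by
    intro h
    apply hne
    have : u ^ 3 * v⁻¹ ^ 2 * v ^ 2 = v ^ 2 := by rw [← hτ, h, one_mul]
    rw [← this]
    calc u ^ 3 = u ^ 3 * (v * v⁻¹) ^ 2 := by rw [hv']; ring
      _ = _ := by ring
  have hxne : x ≠ 0 := by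
    intro h
    rw [h] at e4
    rw [e4] at hu
    simp at hu
  set G : Polynomial K := ∑ m ∈ g.support, Polynomial.C (coeff m g) * Polynomial.X ^ (m 1 + m 2) with hGdef
  have hsum : aeval ![t, u, v] g = x ^ (n / 2) * Polynomial.aeval τ G := by
    rw [aeval_def, eval₂_eq', hGdef, map_sum, Finset.mul_sum]
    refine Finset.sum_congr rfl fun m hm => ?_
    obtain ⟨h0, hw⟩ := hg m (mem_support_iff.mp hm)
    have hn : n / 2 = 2 * m 1 + 3 * m 2 := by omega
    simp only [Fin.prod_univ_three, h0, map_mul, map_pow, Polynomial.aeval_C, Polynomial.aeval_X]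
    simp only [Matrix.cons_val_zero, Matrix.cons_val_one, Matrix.cons_val, pow_zero, one_mul]
    rw [hn]
    nth_rw 1 [e4]
    nth_rw 1 [e6]
    ring
  rw [h0] at hsum
  have hG0 : G = 0 := transc τ hτ1 hτne G (by
    rcases mul_eq_zero.mp hsum.symm with h | h
    · exact absurd (eq_zero_of_pow_eq_zero h) hxne
    · exact h)
  ext m
  rw [coeff_zero]
  by_contra hm
  apply hm
  have h1 := congrArg (fun q => Polynomial.coeff q (m 1 + m 2)) hG0
  simp only [hGdef, Polynomial.finsetSum_coeff, Polynomial.coeff_C_mul_X_pow, Polynomial.coeff_zero] at h1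
  rw [Finset.sum_eq_single m] at h1
  · simpa using h1
  · intro m' hm' hne'
    rw [if_neg]
    intro he
    apply hne'
    obtain ⟨a1, a2⟩ := hg m hm
    obtain ⟨b1, b2⟩ := hg m' (mem_support_iff.mp hm')
    ext i
    fin_cases i <;> simp <;> omega
  · intro h
    exact absurd (mem_support_iff.mpr hm) h

def d12 {S : Type*} [CommRing S] (f : MvPolynomial (Fin 3) S) : MvPolynomial (Fin 3) S :=
  (X 0 ^ 2 - X 1) * pderiv 0 f + 4 * (X 0 * X 1 - X 2) * pderiv 1 f
    + 6 * (X 0 * X 2 - X 1 ^ 2) * pderiv 2 f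

def Vop {S : Type*} [CommRing S] (f : MvPolynomial (Fin 3) S) : MvPolynomial (Fin 3) S :=
  4 * X 2 * pderiv 1 f + 6 * X 1 ^ 2 * pderiv 2 f

lemma map_d12 {S T : Type*} [CommRing S] [CommRing T] (φ : S →+* T) (f : MvPolynomial (Fin 3) S) :
    MvPolynomial.map φ (d12 f) = d12 (MvPolynomial.map φ f) := by
  simp [d12, pderiv_map]

lemma cond_iff {S : Type*} [CommRing S] (n : ℕ) (f : MvPolynomial (Fin 3) S) : Cond n f ↔
    IsWeightedHomogeneous (![(2,1),(4,0),(6,0)] : Fin 3 → ℤ × ℤ) f ((n : ℤ), 0) := by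
  refine forall_congr' fun m => forall_congr' fun h => ?_
  rw [Finsupp.weight_apply, Finsupp.sum_fintype _ _ (by simp), Fin.sum_univ_three]
  simp [Prod.ext_iff]
  omega

lemma cond_euler {S : Type*} [CommRing S] {n : ℕ} {f : MvPolynomial (Fin 3) S} (h : Cond n f) :
    2 * X 0 * pderiv 0 f + 4 * X 1 * pderiv 1 f + 6 * X 2 * pderiv 2 f = (n : MvPolynomial (Fin 3) S) * f := by
  have : IsWeightedHomogeneous ![2, 4, 6] f n := by
    intro m hm
    obtain ⟨a, b⟩ := h m hm
    rw [Finsupp.weight_apply, Finsupp.sum_fintype _ _ (by simp), Fin.sum_univ_three]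
    simp
    omega
  have := this.sum_weight_X_mul_pderiv
  simp [Fin.sum_univ_three] at this
  rw [← this]
  ring

lemma cond_pderiv {S : Type*} [CommRing S] {n : ℕ} {f : MvPolynomial (Fin 3) S} (h : Cond n f) :
    pderiv 0 f = 0 := by
  apply pderiv_eq_zero_of_notMem_vars
  rw [mem_vars_iff_mem_support]
  rintro ⟨m, hm, hi⟩
  exact Finsupp.mem_support_iff.mp hi (h m (mem_support_iff.mp hm)).1

lemma cond_V {S : Type*} [CommRing S] {n : ℕ} {f : MvPolynomial (Fin 3) S} (h : Cond n f) :
    Cond (n + 2) (Vop f) := by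
  rw [cond_iff] at h ⊢
  set w := (![(2,1),(4,0),(6,0)] : Fin 3 → ℤ × ℤ)
  have h1 : IsWeightedHomogeneous w (pderiv 1 f) ((n:ℤ) - 4, 0) := h.pderiv (by simp [w])
  have h2 : IsWeightedHomogeneous w (pderiv 2 f) ((n:ℤ) - 6, 0) := h.pderiv (by simp [w])
  have x1 := isWeightedHomogeneous_X S w 1
  have x2 := isWeightedHomogeneous_X S w 2
  have a1 := ((isWeightedHomogeneous_C w (4:S)).mul x2).mul h1
  have a2 := ((isWeightedHomogeneous_C w (6:S)).mul (x1.pow 2)).mul h2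
  have e : ((0 + w 2) + ((n:ℤ) - 4, 0)) = (((n + 2 : ℕ) : ℤ), 0) := by
    simp [w]; ring
  have e' : (((0 : ℤ × ℤ) + 2 • w 1) + ((n:ℤ) - 6, (0:ℤ))) = (((n + 2 : ℕ) : ℤ), (0:ℤ)) := by
    simp [w, Prod.ext_iff]; ring
  rw [e] at a1
  rw [e'] at a2
  have := a1.add a2
  simpa only [Vop, map_ofNat] using this

lemma cond_Q {S : Type*} [CommRing S] {n : ℕ} {f : MvPolynomial (Fin 3) S} (h : Cond n f) :
    Cond (n + 4) (X 1 * f) := by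
  rw [cond_iff] at h ⊢
  have := (isWeightedHomogeneous_X S (![(2,1),(4,0),(6,0)] : Fin 3 → ℤ × ℤ) 1).mul h
  convert! this using 1
  simp; ring

lemma cond_add {S : Type*} [CommRing S] {n : ℕ} {f g : MvPolynomial (Fin 3) S} (h : Cond n f)
    (h' : Cond n g) : Cond n (f + g) := by
  rw [cond_iff] at h h' ⊢
  exact h.add h'

lemma d12_cond {S : Type*} [CommRing S] {n : ℕ} {f : MvPolynomial (Fin 3) S} (h : Cond n f) :
    d12 f = (n : MvPolynomial (Fin 3) S) * X 0 * f - Vop f := by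
  have h1 := cond_euler h
  have h2 := cond_pderiv h
  rw [d12, Vop]
  rw [h2] at h1 ⊢
  linear_combination X 0 * h1

lemma d12_sq {S : Type*} [CommRing S] {n : ℕ} (hn : (n : S) = -1) {f : MvPolynomial (Fin 3) S} (h : Cond n f) :
    d12 (d12 f) = X 1 * f + Vop (Vop f) := by
  have hn' : (n : MvPolynomial (Fin 3) S) = -1 := by
    rw [← map_natCast C, hn, map_neg, map_one]
  have e1 := d12_cond h
  have e2 := d12_cond (cond_V h)
  have e0 : ∀ g : MvPolynomial (Fin 3) S, d12 (-1 * X 0 * f - g) =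
      -((X 0 ^ 2 - X 1) * f + X 0 * d12 f) - d12 g := by
    intro g
    simp only [d12, map_sub, map_neg, Derivation.leibniz, pderiv_X, neg_mul, one_mul, smul_eq_mul]
    simp
    ring
  have e1' := e0 (Vop f)
  rw [← hn', ← e1] at e1'
  rw [e1', e1, e2]
  push_cast
  rw [hn']
  ring


section Main

lemma thS_add {S : Type*} [CommRing S] (f g : PowerSeries S) : thS (f + g) = thS f + thS g := by
  simp only [thS, map_add, mul_add]

lemma thS_mul {S : Type*} [CommRing S] (f g : PowerSeries S) :
    thS (f * g) = f * thS g + g * thS f := by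
  simp only [thS, Derivation.leibniz, smul_eq_mul]
  ring

lemma thS_C {S : Type*} [CommRing S] (a : S) : thS (PowerSeries.C a) = 0 := by
  ext n
  rw [coeff_thS, PowerSeries.coeff_C]
  split_ifs with h <;> simp [h]

/-- evaluation at the three q-expansions, over any ring -/
def PhiG (S : Type*) [CommRing S] : MvPolynomial (Fin 3) S →ₐ[S] PowerSeries S :=
  aeval ![PowerSeries.map (Int.castRingHom S) e2Z, PowerSeries.map (Int.castRingHom S) e4Z,
    PowerSeries.map (Int.castRingHom S) e6Z]

lemma PhiG_C {S : Type*} [CommRing S] (a : S) : PhiG S (MvPolynomial.C a) = PowerSeries.C a := by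
  rw [PhiG, aeval_C]
  rfl

lemma PhiG_X0 {S : Type*} [CommRing S] : PhiG S (X 0) = PowerSeries.map (Int.castRingHom S) e2Z := by
  simp [PhiG]
lemma PhiG_X1 {S : Type*} [CommRing S] : PhiG S (X 1) = PowerSeries.map (Int.castRingHom S) e4Z := by
  simp [PhiG]
lemma PhiG_X2 {S : Type*} [CommRing S] : PhiG S (X 2) = PowerSeries.map (Int.castRingHom S) e6Z := by
  simp [PhiG]

lemma d12_add {S : Type*} [CommRing S] (f g : MvPolynomial (Fin 3) S) : d12 (f + g) = d12 f + d12 g := by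
  simp only [d12, map_add]
  ring

lemma d12_mul {S : Type*} [CommRing S] (f g : MvPolynomial (Fin 3) S) :
    d12 (f * g) = f * d12 g + g * d12 f := by
  simp only [d12, Derivation.leibniz, smul_eq_mul]
  ring

lemma PhiG_d12_X {S : Type*} [CommRing S] (i : Fin 3) :
    PhiG S (d12 (X i)) = 12 * thS (PhiG S (X i)) := by
  have h2 := congrArg (PowerSeries.map (Int.castRingHom S)) ramZ2
  have h4 := congrArg (PowerSeries.map (Int.castRingHom S)) ramZ4
  have h6 := congrArg (PowerSeries.map (Int.castRingHom S)) ramZ6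
  simp only [map_mul, map_sub, map_pow, map_ofNat, map_thS] at h2 h4 h6
  fin_cases i
  · have : d12 (X 0 : MvPolynomial (Fin 3) S) = X 0 ^ 2 - X 1 := by simp [d12, pderiv_X]
    change PhiG S (d12 (X 0)) = 12 * thS (PhiG S (X 0))
    rw [this]
    simp only [map_sub, map_pow, PhiG_X0, PhiG_X1]
    linear_combination -h2
  · have : d12 (X 1 : MvPolynomial (Fin 3) S) = 4 * (X 0 * X 1 - X 2) := by simp [d12, pderiv_X]
    change PhiG S (d12 (X 1)) = 12 * thS (PhiG S (X 1))
    rw [this]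
    simp only [map_sub, map_mul, map_ofNat, PhiG_X0, PhiG_X1, PhiG_X2]
    linear_combination (-4) * h4
  · have : d12 (X 2 : MvPolynomial (Fin 3) S) = 6 * (X 0 * X 2 - X 1 ^ 2) := by simp [d12, pderiv_X]
    change PhiG S (d12 (X 2)) = 12 * thS (PhiG S (X 2))
    rw [this]
    simp only [map_sub, map_mul, map_pow, map_ofNat, PhiG_X0, PhiG_X1, PhiG_X2]
    linear_combination (-6) * h6

lemma PhiG_d12 {S : Type*} [CommRing S] (f : MvPolynomial (Fin 3) S) :
    PhiG S (d12 f) = 12 * thS (PhiG S f) := by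
  induction f using MvPolynomial.induction_on with
  | C a => 
    rw [PhiG_C, thS_C, mul_zero]
    simp [d12]
  | add f g hf hg => rw [d12_add, map_add, map_add, thS_add, hf, hg, mul_add]
  | mul_X f i hf =>
    rw [d12_mul, map_add, map_mul, map_mul, map_mul, thS_mul, hf, PhiG_d12_X]
    ring

lemma PhiG_map {S T : Type*} [CommRing S] [CommRing T] (φ : S →+* T) (f : MvPolynomial (Fin 3) S) :
    PowerSeries.map φ (PhiG S f) = PhiG T (MvPolynomial.map φ f) := by
  have key : ∀ e : PowerSeries ℤ, PowerSeries.map φ (PowerSeries.map (Int.castRingHom S) e) =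
      PowerSeries.map (Int.castRingHom T) e := by
    intro e
    ext n
    simp
  induction f using MvPolynomial.induction_on with
  | C a => simp
  | add f g hf hg => rw [map_add, map_add, map_add, map_add, hf, hg]
  | mul_X f i hf =>
    rw [map_mul, map_mul, map_mul, map_mul, hf, MvPolynomial.map_X]
    congr 1
    fin_cases i
    · change PowerSeries.map φ (PhiG S (X 0)) = PhiG T (X 0)
      rw [PhiG_X0, PhiG_X0, key]
    · change PowerSeries.map φ (PhiG S (X 1)) = PhiG T (X 1)
      rw [PhiG_X1, PhiG_X1, key]
    · change PowerSeries.map φ (PhiG S (X 2)) = PhiG T (X 2)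
      rw [PhiG_X2, PhiG_X2, key]

lemma Phi_eq : Phi = PhiG ℚ := by
  have e2 : E2s = PowerSeries.map (Int.castRingHom ℚ) e2Z := by
    ext n
    simp only [E2s, e2Z, sigmaQ, PowerSeries.coeff_mk, PowerSeries.coeff_map, ArithmeticFunction.sigma_apply]
    split_ifs <;> simp
  have e4 : E4s = PowerSeries.map (Int.castRingHom ℚ) e4Z := by
    ext n
    simp only [E4s, e4Z, sigmaQ, PowerSeries.coeff_mk, PowerSeries.coeff_map, ArithmeticFunction.sigma_apply]
    split_ifs <;> simp
  have e6 : E6s = PowerSeries.map (Int.castRingHom ℚ) e6Z := by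
    ext n
    simp only [E6s, e6Z, sigmaQ, PowerSeries.coeff_mk, PowerSeries.coeff_map, ArithmeticFunction.sigma_apply]
    split_ifs <;> simp
  rw [Phi, PhiG, e2, e4, e6]

lemma d12_Dop (f : Poly3) : d12 f = MvPolynomial.C 12 * Dop f := by
  have h1 : (MvPolynomial.C (12:ℚ) : Poly3) * MvPolynomial.C (1/12) = 1 := by rw [← map_mul]; norm_num
  have h2 : (MvPolynomial.C (12:ℚ) : Poly3) * MvPolynomial.C (1/3) = 4 := by
    rw [← map_mul, ← map_ofNat MvPolynomial.C]; norm_num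
  have h3 : (MvPolynomial.C (12:ℚ) : Poly3) * MvPolynomial.C (1/2) = 6 := by
    rw [← map_mul, ← map_ofNat MvPolynomial.C]; norm_num
  rw [d12, Dop]
  linear_combination (-(X 0 ^ 2 - X 1) * pderiv 0 f) * h1 -
    ((X 0 * X 1 - X 2) * pderiv 1 f) * h2 - ((X 0 * X 2 - X 1 ^ 2) * pderiv 2 f) * h3

lemma d12_sq_Dop (f : Poly3) : d12 (d12 f) = MvPolynomial.C 144 * Dop (Dop f) := by
  rw [d12_Dop f, d12_mul, d12_Dop (Dop f)]
  have : d12 (MvPolynomial.C (12:ℚ)) = 0 := by simp [d12]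
  rw [this, mul_zero, add_zero, ← mul_assoc, ← map_mul]
  norm_num

lemma norm_bern (p : ℕ) [hp : Fact p.Prime] (hp5 : 5 ≤ p) : ‖((bernoulli (p - 1) : ℚ) : ℚ_[p])‖ = p := by
  obtain ⟨k, hk⟩ : ∃ k, p - 1 = 2 * k := by
    obtain ⟨k, hk⟩ := hp.out.odd_of_ne_two (by omega)
    exact ⟨k, by omega⟩
  obtain ⟨z, hz⟩ := Bernoulli.vonStaudt_clausen k
  rw [← hk] at hz
  set s := {q ∈ range (p - 1 + 2) | q.Prime ∧ (q - 1) ∣ p - 1} with hs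
  have hps : p ∈ s := by
    rw [hs, Finset.mem_filter, Finset.mem_range]
    exact ⟨by omega, hp.out, dvd_rfl⟩
  rw [← Finset.add_sum_erase s _ hps] at hz
  set t := ∑ q ∈ s.erase p, (1:ℚ) / q with ht
  have hb : bernoulli (p - 1) = ((z : ℚ) - t) + (-(1 / (p:ℚ))) := by linarith
  have htn : ‖((t : ℚ) : ℚ_[p])‖ ≤ 1 := by
    rw [ht, Rat.cast_sum]
    apply IsUltrametricDist.norm_sum_le_of_forall_le_of_nonneg zero_le_one
    intro q hq
    have hqp : q.Prime := (Finset.mem_filter.mp (Finset.mem_of_mem_erase hq)).2.1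
    have hne : q ≠ p := Finset.ne_of_mem_erase hq
    have : ‖(q : ℚ_[p])‖ = 1 := by
      rw [Padic.norm_natCast_eq_one_iff]
      exact (Nat.coprime_primes hp.out hqp).mpr hne.symm
    push_cast
    rw [norm_div, this, norm_one, div_one]
  have h1 : ‖(((z : ℚ) - t : ℚ) : ℚ_[p])‖ ≤ 1 := by
    push_cast
    rw [sub_eq_add_neg]
    refine (Padic.nonarchimedean _ _).trans (max_le (Padic.norm_int_le_one z) ?_)
    rw [norm_neg]
    exact htn
  have h2 : ‖((-(1 / (p:ℚ)) : ℚ) : ℚ_[p])‖ = p := by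
    push_cast
    rw [norm_neg, norm_div, norm_one, Padic.norm_p, one_div, inv_inv]
  have h3 : (1:ℝ) < p := by exact_mod_cast hp.out.one_lt
  rw [hb, Rat.cast_add, Padic.add_eq_max_of_ne (by rw [h2]; linarith), h2]
  exact max_eq_right (by linarith)

lemma norm_EA (p : ℕ) [hp : Fact p.Prime] (hp5 : 5 ≤ p) (n : ℕ) (hn : n ≠ 0) :
    ‖((PowerSeries.coeff n (EAs p) : ℚ) : ℚ_[p])‖ < 1 := by
  have h3 : (1:ℝ) < p := by exact_mod_cast hp.out.one_lt
  have e : PowerSeries.coeff n (EAs p) = ((-(2 * ((p:ℤ) - 1)) * ∑ d ∈ n.divisors, (d:ℤ) ^ (p - 2) : ℤ) : ℚ) /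
      bernoulli (p - 1) := by
    rw [EAs, PowerSeries.coeff_mk, if_neg hn, sigmaQ]
    push_cast
    ring
  rw [e, Rat.cast_div, norm_div, norm_bern p hp5, div_lt_one (by linarith), Rat.cast_intCast]
  exact (Padic.norm_int_le_one _).trans_lt h3

lemma pInt_of_norm (p : ℕ) [hp : Fact p.Prime] (x : ℚ) (h : ‖(x : ℚ_[p])‖ ≤ 1) : pInt p x := by
  have := PadicInt.isUnit_den x h
  rw [PadicInt.isUnit_iff, PadicInt.norm_natCast_eq_one_iff] at this
  intro hd
  exact (hp.out.coprime_iff_not_dvd.mp this) hd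

lemma toZMod_zero_iff (p : ℕ) [hp : Fact p.Prime] (x : ℤ_[p]) :
    PadicInt.toZMod x = 0 ↔ ‖(x : ℚ_[p])‖ < 1 := by
  rw [← RingHom.mem_ker, PadicInt.ker_toZMod, IsLocalRing.mem_maximalIdeal, PadicInt.mem_nonunits]
  rfl

lemma ne_modp (p : ℕ) [hp : Fact p.Prime] (hp5 : 5 ≤ p) :
    (PowerSeries.map (Int.castRingHom (ZMod p)) e4Z) ^ 3 ≠ (PowerSeries.map (Int.castRingHom (ZMod p)) e6Z) ^ 2 := by
  intro h
  have := congrArg (PowerSeries.coeff 1) h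
  rw [PowerSeries.coeff_one_pow, PowerSeries.coeff_one_pow] at this
  rw [← PowerSeries.coeff_zero_eq_constantCoeff_apply, ← PowerSeries.coeff_zero_eq_constantCoeff_apply] at this
  simp [e4Z, e6Z] at this
  have h1 : ((1728 : ℕ) : ZMod p) = 0 := by
    push_cast
    linear_combination this
  rw [ZMod.natCast_eq_zero_iff] at h1
  have h2 : p ∣ 2 ^ 6 * 3 ^ 3 := by simpa using h1
  rcases (Nat.Prime.dvd_mul hp.out).mp h2 with h | h
  · have := Nat.le_of_dvd (by norm_num) (hp.out.dvd_of_dvd_pow h)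
    omega
  · have := Nat.le_of_dvd (by norm_num) (hp.out.dvd_of_dvd_pow h)
    omega

lemma modp_zero (p : ℕ) [hp : Fact p.Prime] (hp5 : 5 ≤ p) (f : MvPolynomial (Fin 3) (ZMod p))
    (hc : Cond (p - 1) f) (h1 : PhiG (ZMod p) f = 1) : d12 (d12 f) = 0 := by
  have hn : ((p - 1 : ℕ) : ZMod p) = -1 := by
    rw [Nat.cast_sub hp.out.one_lt.le]
    simp
  have e := d12_sq hn hc
  have hC : Cond (p - 1 + 4) (d12 (d12 f)) := by
    rw [e]
    exact cond_add (cond_Q hc) (cond_V (cond_V hc))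
  refine inj_qexp _ _ _ ?_ ?_ (ne_modp p hp5) _ hC (?_ : PhiG (ZMod p) (d12 (d12 f)) = 0)
  · rw [← PowerSeries.coeff_zero_eq_constantCoeff_apply]
    simp [e4Z]
  · rw [← PowerSeries.coeff_zero_eq_constantCoeff_apply]
    simp [e6Z]
  · have h0 : thS (1 : PowerSeries (ZMod p)) = 0 := by
      have := thS_C (1 : ZMod p)
      rwa [map_one] at this
    have h00 : thS (0 : PowerSeries (ZMod p)) = 0 := by
      have := thS_C (0 : ZMod p)
      rwa [map_zero] at this
    rw [PhiG_d12, PhiG_d12, h1, h0, mul_zero, h00, mul_zero]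

end Main

theorem stmt_4 (p : ℕ) (hp : p.Prime) (hp5 : 5 ≤ p)
    (A : Poly3) (hAiso : Isobaric (p - 1) A) (hAnoP : NoP A)
    (hAint : polyPInt p A) (hAPhi : Phi A = EAs p) :
    ∀ m : Fin 3 →₀ ℕ, ∃ y : ℚ, pInt p y ∧ coeff m (Dop^[2] A) = p * y := by
  have : Fact p.Prime := ⟨hp⟩
  let c : (Fin 3 →₀ ℕ) → ℤ_[p] := fun m => ⟨((coeff m A : ℚ) : ℚ_[p]), Padic.norm_rat_le_one (hAint m)⟩
  let A' : MvPolynomial (Fin 3) ℤ_[p] := ∑ m ∈ A.support, monomial m (c m)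
  let ι : ℤ_[p] →+* ℚ_[p] := PadicInt.Coe.ringHom
  let j : ℚ →+* ℚ_[p] := Rat.castHom ℚ_[p]
  have hmap : MvPolynomial.map ι A' = MvPolynomial.map j A := by
    conv_rhs => rw [A.as_sum]
    rw [map_sum, map_sum]
    refine Finset.sum_congr rfl fun m _ => ?_
    rw [map_monomial, map_monomial]
    rfl
  have hcoeff : ∀ m, coeff m A = 0 → coeff m A' = 0 := by
    intro m hm
    have h := congrArg (coeff m) hmap
    rw [coeff_map, coeff_map, hm, map_zero] at h
    exact Subtype.ext h
  have hcond : Cond (p - 1) (MvPolynomial.map PadicInt.toZMod A') := by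
    intro m hm
    have hm' : coeff m A ≠ 0 := by
      intro h
      apply hm
      rw [coeff_map, hcoeff m h, map_zero]
    have h1 := hAiso m (mem_support_iff.mpr hm')
    have h2 := hAnoP m (mem_support_iff.mpr hm')
    exact ⟨h2, by omega⟩
  have hPhi : PowerSeries.map ι (PhiG ℤ_[p] A') = PowerSeries.map j (EAs p) := by
    rw [PhiG_map, hmap, ← PhiG_map, ← Phi_eq, hAPhi]
  have hone : PhiG (ZMod p) (MvPolynomial.map PadicInt.toZMod A') = 1 := by
    rw [← PhiG_map]
    ext n
    have h := congrArg (PowerSeries.coeff n) hPhi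
    rw [PowerSeries.coeff_map, PowerSeries.coeff_map] at h
    rw [PowerSeries.coeff_map, PowerSeries.coeff_one]
    split_ifs with hn
    · subst hn
      have h1 : PowerSeries.coeff 0 (EAs p) = 1 := by simp [EAs]
      rw [h1, map_one] at h
      have h2 : PowerSeries.coeff 0 (PhiG ℤ_[p] A') = 1 := Subtype.ext h
      rw [h2, map_one]
    · rw [toZMod_zero_iff]
      have h1 := norm_EA p hp5 n hn
      change ‖ι _‖ < 1
      rw [h]
      exact h1
  have hzero := modp_zero p hp5 _ hcond hone
  rw [← map_d12, ← map_d12] at hzero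
  intro m
  have hm := congrArg (coeff m) hzero
  rw [coeff_map, coeff_zero, toZMod_zero_iff] at hm
  have h144 : MvPolynomial.map ι (d12 (d12 A')) = MvPolynomial.map j (MvPolynomial.C 144 * Dop (Dop A)) := by
    rw [map_d12, map_d12, hmap, ← map_d12, ← map_d12, d12_sq_Dop]
  have h := congrArg (coeff m) h144
  rw [coeff_map, coeff_map, coeff_C_mul, map_mul] at h
  have hlt : ‖((coeff m (Dop (Dop A)) : ℚ) : ℚ_[p])‖ < 1 := by
    have h1 : ‖ι (coeff m (d12 (d12 A')))‖ < 1 := hm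
    rw [h, norm_mul] at h1
    have h2 : ‖j 144‖ = 1 := by
      have : j 144 = ((144 : ℕ) : ℚ_[p]) := by simp
      rw [this, Padic.norm_natCast_eq_one_iff, Nat.coprime_comm, Nat.coprime_comm, hp.coprime_iff_not_dvd]
      intro hd
      have h2 : p ∣ 2 ^ 4 * 3 ^ 2 := by simpa using hd
      rcases (Nat.Prime.dvd_mul hp).mp h2 with h | h
      · have := Nat.le_of_dvd (by norm_num) (hp.dvd_of_dvd_pow h)
        omega
      · have := Nat.le_of_dvd (by norm_num) (hp.dvd_of_dvd_pow h)
        omega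
    rw [h2, one_mul] at h1
    exact h1
  have hp0 : (p : ℚ) ≠ 0 := by exact_mod_cast hp.ne_zero
  refine ⟨coeff m (Dop (Dop A)) / p, pInt_of_norm p _ ?_, ?_⟩
  · have hx : ‖((coeff m (Dop (Dop A)) : ℚ) : ℚ_[p])‖ ≤ (p : ℝ) ^ (-1 : ℤ) := by
      rw [Padic.norm_le_pow_iff_norm_lt_pow_add_one]
      simpa using hlt
    have hpp : (0:ℝ) < p := by exact_mod_cast hp.pos
    rw [Rat.cast_div, norm_div, Rat.cast_natCast, Padic.norm_p, div_le_one (by positivity)]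
    simpa using hx
  · change coeff m (Dop (Dop A)) = _
    field_simp
end
end
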